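/- For every integer n ≥ 3, there exists a 3-regular, weakly connected, acyclic finite directed multigraph on 2n vertices with a unique source and a unique sink having exactly 9 · 2^{n−3} source-to-sink paths. -/

import Mathlib

/-- A finite directed multigraph with vertex set `Fin m` and edge set `Fin q`,
given by source and target maps. -/
structure Multigraph (m q : ℕ) where
  src : Fin q → Fin m
  tgt : Fin q → Fin m

namespace Multigraph

variable {m q : ℕ}

/-- `p` is a directed path from `u` to `v`: a nonempty list of edges whose first edge
starts at `u`, whose last edge ends at `v`, and where consecutive edges are composable. -/
def IsPath (D : Multigraph m q) (u v : Fin m) (p : List (Fin q)) : Prop :=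
  (∃ e rest, p = e :: rest ∧ D.src e = u) ∧
  (∃ e rest, p = rest ++ [e] ∧ D.tgt e = v) ∧
  p.Chain' (fun a b => D.tgt a = D.src b)

/-- The number of directed paths from `u` to `v` (paths counted as edge sequences). -/
noncomputable def pathCount (D : Multigraph m q) (u v : Fin m) : ℕ :=
  Nat.card {p : List (Fin q) // D.IsPath u v p}

/-- `D` is acyclic: no vertex has a directed path to itself. -/
def Acyclic (D : Multigraph m q) : Prop :=
  ∀ v : Fin m, ¬ ∃ p, D.IsPath v v p

/-- In-degree of a vertex. -/
def indeg (D : Multigraph m q) (v : Fin m) : ℕ :=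
  (Finset.univ.filter (fun e => D.tgt e = v)).card

/-- Out-degree of a vertex. -/
def outdeg (D : Multigraph m q) (v : Fin m) : ℕ :=
  (Finset.univ.filter (fun e => D.src e = v)).card

/-- `D` is 3-regular: every vertex has total degree 3. -/
def ThreeRegular (D : Multigraph m q) : Prop :=
  ∀ v : Fin m, D.indeg v + D.outdeg v = 3

/-- `s` is the unique source (vertex of in-degree 0) of `D`. -/
def UniqueSource (D : Multigraph m q) (s : Fin m) : Prop :=
  D.indeg s = 0 ∧ ∀ v : Fin m, D.indeg v = 0 → v = s

/-- `t` is the unique sink (vertex of out-degree 0) of `D`. -/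
def UniqueSink (D : Multigraph m q) (t : Fin m) : Prop :=
  D.outdeg t = 0 ∧ ∀ v : Fin m, D.outdeg v = 0 → v = t

/-- `μ_D(v)`: the number of directed paths from `s` to `v`, with `μ_D(s) = 1`. -/
noncomputable def mu (D : Multigraph m q) (s v : Fin m) : ℕ :=
  if v = s then 1 else D.pathCount s v

/-- Two vertices are adjacent (disregarding orientation) via an edge in `S`. -/
def Adj (D : Multigraph m q) (S : Set (Fin q)) (a b : Fin m) : Prop :=
  ∃ e ∈ S, (D.src e = a ∧ D.tgt e = b) ∨ (D.src e = b ∧ D.tgt e = a)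

/-- Weak connectivity using only the edges in `S`: any two distinct vertices are joined
by a finite sequence of edges of `S` traversed in either direction. -/
def WeaklyConnectedOn (D : Multigraph m q) (S : Set (Fin q)) : Prop :=
  ∀ a b : Fin m, a ≠ b → Relation.ReflTransGen (D.Adj S) a b

/-- `D` is weakly connected. -/
def WeaklyConnected (D : Multigraph m q) : Prop :=
  D.WeaklyConnectedOn Set.univ

/-- `D` is `ℓ`-edge connected: it has at least two vertices, and deleting any set of at
most `ℓ - 1` edges leaves a weakly connected multigraph. -/
def EdgeConnected (D : Multigraph m q) (ℓ : ℕ) : Prop :=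
  2 ≤ m ∧ ∀ F : Finset (Fin q), F.card ≤ ℓ - 1 → D.WeaklyConnectedOn {e | e ∉ F}

/-- `p` is a directed Hamiltonian path of `D` starting at `u`: a directed path that
visits every vertex exactly once. -/
def IsHamiltonianPath (D : Multigraph m q) (u : Fin m) (p : List (Fin q)) : Prop :=
  (∃ v, D.IsPath u v p) ∧ (u :: p.map D.tgt).Nodup ∧
    ∀ w : Fin m, w ∈ u :: p.map D.tgt

/-- `D` contains a directed Hamiltonian path. -/
def HasHamiltonianPath (D : Multigraph m q) : Prop :=
  ∃ u p, D.IsHamiltonianPath u p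

/-- `D` is simple: no two distinct edges have the same unordered pair of endpoints. -/
def Simple (D : Multigraph m q) : Prop :=
  ∀ e e' : Fin q, e ≠ e' →
    ¬ ((D.src e = D.src e' ∧ D.tgt e = D.tgt e') ∨
       (D.src e = D.tgt e' ∧ D.tgt e = D.src e'))

/-- `D` together with designated edges `H i` (from vertex `i` to vertex `i+1`, 0-based)
is a Hamiltonian-path digraph: the designated edges are pairwise distinct, form the
Hamiltonian path, and every edge goes from a smaller vertex to a larger one.
(Vertices `0, …, m-1` here represent the vertices `1, …, m`.) -/
def IsHamPathDigraph (D : Multigraph m q) (H : Fin (m - 1) → Fin q) : Prop :=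
  Function.Injective H ∧
  (∀ i : Fin (m - 1), (D.src (H i)).val = i.val ∧ (D.tgt (H i)).val = i.val + 1) ∧
  ∀ e : Fin q, (D.src e).val < (D.tgt e).val

end Multigraph

namespace Multigraph

section General

variable {m q : ℕ} {D : Multigraph m q}

/-- A possibly empty directed walk from `u` to `v`. -/
def IsWalk (D : Multigraph m q) (u v : Fin m) (p : List (Fin q)) : Prop :=
  (p = [] ∧ v = u) ∨ D.IsPath u v p

theorem not_isPath_nil (u v : Fin m) : ¬ D.IsPath u v [] := by
  rintro ⟨⟨e, rest, h, -⟩, -⟩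
  simp at h

theorem isPath_iff {u v : Fin m} {p : List (Fin q)} :
    D.IsPath u v p ↔ p.head?.map D.src = some u ∧ p.getLast?.map D.tgt = some v ∧
      p.IsChain (fun a b => D.tgt a = D.src b) := by
  refine and_congr ?_ (and_congr ?_ Iff.rfl)
  · cases p <;> simp
  · rcases List.eq_nil_or_concat' p with rfl | ⟨r, e, rfl⟩ <;> simp [and_comm, and_assoc]

theorem isPath_append_singleton {u v : Fin m} {r : List (Fin q)} {e : Fin q} :
    D.IsPath u v (r ++ [e]) ↔ D.tgt e = v ∧ D.IsWalk u (D.src e) r := by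
  simp only [IsWalk, isPath_iff, List.isChain_append]
  rcases List.eq_nil_or_concat' r with rfl | ⟨r, f, rfl⟩
  · simp [and_comm, eq_comm]
  · simp
    grind

theorem finite_isWalk (h : ∀ e, D.src e < D.tgt e) (u v : Fin m) :
    Finite {p : List (Fin q) // D.IsWalk u v p} := by
  have nodup : ∀ p : List (Fin q), D.IsWalk u v p → p.Nodup := by
    rintro p (⟨rfl, -⟩ | ⟨-, -, hc⟩)
    · simp
    · have hsrc : p.IsChain (fun a b => D.src a < D.src b) :=
        List.IsChain.imp (fun {a b} (hab : D.tgt a = D.src b) => hab ▸ h a) hc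
      have : IsTrans (Fin q) (fun a b => D.src a < D.src b) := ⟨fun _ _ _ => lt_trans⟩
      exact (List.isChain_iff_pairwise.1 hsrc).imp fun hab he => by simp [he] at hab
  exact Finite.of_injective (β := {p : List (Fin q) // p.Nodup})
    (fun p => ⟨p.1, nodup p.1 p.2⟩) fun p p' hp => Subtype.ext (by simpa using hp)

theorem lt_of_isPath (h : ∀ e, D.src e < D.tgt e) (u v : Fin m) (p : List (Fin q))
    (hp : D.IsPath u v p) : u < v := by
  induction p using List.reverseRecOn generalizing v with
  | nil => exact absurd hp (not_isPath_nil u v)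
  | append_singleton r e ih =>
    obtain ⟨rfl, ⟨-, hs⟩ | hr⟩ := isPath_append_singleton.1 hp
    · exact hs ▸ h e
    · exact (ih _ hr).trans (h e)

theorem acyclic_of_src_lt_tgt (h : ∀ e, D.src e < D.tgt e) : D.Acyclic :=
  fun v ⟨p, hp⟩ => lt_irrefl v (lt_of_isPath h v v p hp)

theorem mu_eq_card_isWalk (h : ∀ e, D.src e < D.tgt e) (s v : Fin m) :
    D.mu s v = Nat.card {p : List (Fin q) // D.IsWalk s v p} := by
  unfold mu pathCount
  split_ifs with hv
  · subst hv
    have huniq : ∀ p, D.IsWalk v v p ↔ p = [] := fun p =>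
      ⟨fun hp => hp.elim And.left fun hp => absurd ⟨p, hp⟩ (acyclic_of_src_lt_tgt h v),
        fun hp => Or.inl ⟨hp, rfl⟩⟩
    simp [huniq]
  · simp [IsWalk, hv]

theorem mu_eq_sum (h : ∀ e, D.src e < D.tgt e) {s v : Fin m} (hv : v ≠ s) :
    D.mu s v = ∑ e with D.tgt e = v, D.mu s (D.src e) := by
  have := finite_isWalk h
  let f : (Σ e : {e // D.tgt e = v}, {r : List (Fin q) // D.IsWalk s (D.src e) r}) →
      {p : List (Fin q) // D.IsWalk s v p} := fun x =>
    ⟨x.2.1 ++ [x.1.1], Or.inr (isPath_append_singleton.2 ⟨x.1.2, x.2.2⟩)⟩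
  have hf : Function.Bijective f := by
    constructor
    · rintro ⟨⟨e, he⟩, r, hr⟩ ⟨⟨e', he'⟩, r', hr'⟩ heq
      obtain ⟨rfl, h2⟩ := List.append_inj' (congrArg Subtype.val heq) rfl
      obtain rfl : e = e' := by simpa using h2
      rfl
    · rintro ⟨p, ⟨-, hp⟩ | hp⟩
      · exact absurd hp hv
      · rcases List.eq_nil_or_concat' p with rfl | ⟨r, e, rfl⟩
        · exact absurd hp (not_isPath_nil s v)
        · obtain ⟨he, hr⟩ := isPath_append_singleton.1 hp
          exact ⟨⟨⟨e, he⟩, r, hr⟩, rfl⟩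
  rw [mu_eq_card_isWalk h, ← Nat.card_congr (Equiv.ofBijective f hf), Nat.card_sigma]
  simp only [← mu_eq_card_isWalk h]
  exact (Finset.sum_subtype _ (by simp) fun e => D.mu s (D.src e)).symm

theorem weaklyConnected_of_uniqueSource (h : ∀ e, D.src e < D.tgt e) {s : Fin m}
    (hs : D.UniqueSource s) : D.WeaklyConnected := by
  have reach : ∀ v, Relation.ReflTransGen (D.Adj Set.univ) s v := by
    intro v
    induction v using WellFoundedLT.induction with
    | ind v ih =>
      by_cases hv : v = s
      · rw [hv]
      · obtain ⟨e, he⟩ := Finset.card_ne_zero.1 (mt (hs.2 v) hv)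
        obtain rfl : D.tgt e = v := by simpa using he
        exact (ih _ (h e)).tail ⟨e, trivial, Or.inl ⟨rfl, rfl⟩⟩
  have : Std.Symm (D.Adj Set.univ) := ⟨fun a b ⟨e, he, hab⟩ => ⟨e, he, hab.symm⟩⟩
  exact fun a b _ => (Std.Symm.symm _ _ (reach a)).trans (reach b)

end General

/-- Three edges leaving the source `0` are merged into one at vertex `2`, then the number of
paths is doubled `k` times by a double edge from `2 i + 3` to `2 i + 4`, and finally the single
edge is split into the three edges entering the sink `2 k + 5`. -/
def doublingChain (k : ℕ) : Multigraph (2 * (k + 3)) (3 * (k + 3)) where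
  src e := ⟨if e.val < 3 then 0 else if e.val = 3 * k + 8 then 2 * k + 4
    else (2 * e.val - 1) / 3, by split_ifs <;> omega⟩
  tgt e := ⟨if e.val = 0 then 1 else if 3 * k + 6 ≤ e.val then 2 * k + 5
    else (2 * e.val + 2) / 3, by split_ifs <;> omega⟩

namespace doublingChain

variable (k : ℕ)

theorem src_lt_tgt (e : Fin (3 * (k + 3))) :
    (doublingChain k).src e < (doublingChain k).tgt e := by
  simp only [doublingChain, Fin.lt_def]
  split_ifs <;> omega

theorem tgt_val (e : Fin (3 * (k + 3))) :
    ((doublingChain k).tgt e).val = if e.val = 0 then 1 else if 3 * k + 6 ≤ e.val then 2 * k + 5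
      else (2 * e.val + 2) / 3 := rfl

theorem src_val (e : Fin (3 * (k + 3))) :
    ((doublingChain k).src e).val = if e.val < 3 then 0 else if e.val = 3 * k + 8 then 2 * k + 4
      else (2 * e.val - 1) / 3 := rfl

theorem filter_tgt_zero (v : Fin (2 * (k + 3))) (hv : v.val = 0) :
    Finset.univ.filter (fun e => (doublingChain k).tgt e = v) = ∅ := by
  ext e
  simp only [Finset.mem_filter, Finset.mem_univ, true_and, Fin.ext_iff, tgt_val,
    Finset.notMem_empty, iff_false]
  split_ifs <;> omega

theorem filter_tgt_one (v : Fin (2 * (k + 3))) (hv : v.val = 1) :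
    Finset.univ.filter (fun e => (doublingChain k).tgt e = v) =
      {⟨0, by omega⟩, ⟨1, by omega⟩} := by
  ext e
  simp only [Finset.mem_filter, Finset.mem_univ, true_and, tgt_val, Finset.mem_insert,
    Finset.mem_singleton, Fin.ext_iff]
  split_ifs <;> omega

theorem filter_tgt_odd (i : ℕ) (hi : i ≤ k) (v : Fin (2 * (k + 3))) (hv : v.val = 2 * i + 3) :
    Finset.univ.filter (fun e => (doublingChain k).tgt e = v) = {⟨3 * i + 4, by omega⟩} := by
  ext e
  simp only [Finset.mem_filter, Finset.mem_univ, true_and, tgt_val,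
    Finset.mem_singleton, Fin.ext_iff]
  split_ifs <;> omega

theorem filter_tgt_even (i : ℕ) (hi : i ≤ k) (v : Fin (2 * (k + 3))) (hv : v.val = 2 * i + 2) :
    Finset.univ.filter (fun e => (doublingChain k).tgt e = v) =
      {⟨3 * i + 2, by omega⟩, ⟨3 * i + 3, by omega⟩} := by
  ext e
  simp only [Finset.mem_filter, Finset.mem_univ, true_and, tgt_val, Finset.mem_insert,
    Finset.mem_singleton, Fin.ext_iff]
  split_ifs <;> omega

theorem filter_tgt_last_split (v : Fin (2 * (k + 3))) (hv : v.val = 2 * k + 4) :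
    Finset.univ.filter (fun e => (doublingChain k).tgt e = v) = {⟨3 * k + 5, by omega⟩} := by
  ext e
  simp only [Finset.mem_filter, Finset.mem_univ, true_and, tgt_val,
    Finset.mem_singleton, Fin.ext_iff]
  split_ifs <;> omega

theorem filter_tgt_sink (v : Fin (2 * (k + 3))) (hv : v.val = 2 * k + 5) :
    Finset.univ.filter (fun e => (doublingChain k).tgt e = v) =
      {⟨3 * k + 6, by omega⟩, ⟨3 * k + 7, by omega⟩, ⟨3 * k + 8, by omega⟩} := by
  ext e
  simp only [Finset.mem_filter, Finset.mem_univ, true_and, tgt_val, Finset.mem_insert,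
    Finset.mem_singleton, Fin.ext_iff]
  split_ifs <;> omega

theorem filter_src_zero (v : Fin (2 * (k + 3))) (hv : v.val = 0) :
    Finset.univ.filter (fun e => (doublingChain k).src e = v) =
      {⟨0, by omega⟩, ⟨1, by omega⟩, ⟨2, by omega⟩} := by
  ext e
  simp only [Finset.mem_filter, Finset.mem_univ, true_and, src_val, Finset.mem_insert,
    Finset.mem_singleton, Fin.ext_iff]
  split_ifs <;> omega

theorem filter_src_one (v : Fin (2 * (k + 3))) (hv : v.val = 1) :
    Finset.univ.filter (fun e => (doublingChain k).src e = v) = {⟨3, by omega⟩} := by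
  ext e
  simp only [Finset.mem_filter, Finset.mem_univ, true_and, src_val,
    Finset.mem_singleton, Fin.ext_iff]
  split_ifs <;> omega

theorem filter_src_even (i : ℕ) (hi : i ≤ k) (v : Fin (2 * (k + 3))) (hv : v.val = 2 * i + 2) :
    Finset.univ.filter (fun e => (doublingChain k).src e = v) = {⟨3 * i + 4, by omega⟩} := by
  ext e
  simp only [Finset.mem_filter, Finset.mem_univ, true_and, src_val,
    Finset.mem_singleton, Fin.ext_iff]
  split_ifs <;> omega

theorem filter_src_odd (i : ℕ) (hi : i ≤ k) (v : Fin (2 * (k + 3))) (hv : v.val = 2 * i + 3) :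
    Finset.univ.filter (fun e => (doublingChain k).src e = v) =
      {⟨3 * i + 5, by omega⟩, ⟨3 * i + 6, by omega⟩} := by
  ext e
  simp only [Finset.mem_filter, Finset.mem_univ, true_and, src_val, Finset.mem_insert,
    Finset.mem_singleton, Fin.ext_iff]
  split_ifs <;> omega

theorem filter_src_last_split (v : Fin (2 * (k + 3))) (hv : v.val = 2 * k + 4) :
    Finset.univ.filter (fun e => (doublingChain k).src e = v) =
      {⟨3 * k + 7, by omega⟩, ⟨3 * k + 8, by omega⟩} := by
  ext e
  simp only [Finset.mem_filter, Finset.mem_univ, true_and, src_val, Finset.mem_insert,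
    Finset.mem_singleton, Fin.ext_iff]
  split_ifs <;> omega

theorem filter_src_sink (v : Fin (2 * (k + 3))) (hv : v.val = 2 * k + 5) :
    Finset.univ.filter (fun e => (doublingChain k).src e = v) = ∅ := by
  ext e
  simp only [Finset.mem_filter, Finset.mem_univ, true_and, Fin.ext_iff, src_val,
    Finset.notMem_empty, iff_false]
  split_ifs <;> omega

theorem vertex_cases (v : Fin (2 * (k + 3))) :
    v.val = 0 ∨ v.val = 1 ∨ (∃ i ≤ k, v.val = 2 * i + 2) ∨ (∃ i ≤ k, v.val = 2 * i + 3) ∨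
      v.val = 2 * k + 4 ∨ v.val = 2 * k + 5 := by
  rcases Nat.even_or_odd' v.val with ⟨j, hj | hj⟩
  · by_cases h0 : j = 0
    · omega
    · by_cases hk : j ≤ k + 1
      · exact Or.inr (Or.inr (Or.inl ⟨j - 1, by omega, by omega⟩))
      · omega
  · by_cases h0 : j = 0
    · omega
    · by_cases hk : j ≤ k + 1
      · exact Or.inr (Or.inr (Or.inr (Or.inl ⟨j - 1, by omega, by omega⟩)))
      · omega

/-- In- and out-degrees of all vertices. -/
theorem degrees (v : Fin (2 * (k + 3))) :
    (v.val = 0 ∧ (doublingChain k).indeg v = 0 ∧ (doublingChain k).outdeg v = 3) ∨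
    (v.val = 2 * k + 5 ∧ (doublingChain k).indeg v = 3 ∧ (doublingChain k).outdeg v = 0) ∨
    ((doublingChain k).indeg v = 2 ∧ (doublingChain k).outdeg v = 1) ∨
    ((doublingChain k).indeg v = 1 ∧ (doublingChain k).outdeg v = 2) := by
  unfold indeg outdeg
  rcases vertex_cases k v with hv | hv | ⟨i, hi, hv⟩ | ⟨i, hi, hv⟩ | hv | hv
  · rw [filter_tgt_zero k v hv, filter_src_zero k v hv]
    simp [hv, Finset.card_insert_of_notMem]
  · rw [filter_tgt_one k v hv, filter_src_one k v hv]
    simp [Finset.card_insert_of_notMem]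
  · rw [filter_tgt_even k i hi v hv, filter_src_even k i hi v hv]
    simp [Finset.card_insert_of_notMem]
  · rw [filter_tgt_odd k i hi v hv, filter_src_odd k i hi v hv]
    simp [Finset.card_insert_of_notMem]
  · rw [filter_tgt_last_split k v hv, filter_src_last_split k v hv]
    simp [Finset.card_insert_of_notMem]
  · rw [filter_tgt_sink k v hv, filter_src_sink k v hv]
    simp [hv, Finset.card_insert_of_notMem]

theorem threeRegular : (doublingChain k).ThreeRegular := fun v => by
  rcases degrees k v with h | h | h | h <;> omega

theorem uniqueSource : (doublingChain k).UniqueSource ⟨0, by omega⟩ := by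
  refine ⟨?_, fun v hv => Fin.ext ?_⟩
  · rw [indeg, filter_tgt_zero k _ rfl, Finset.card_empty]
  · rcases degrees k v with h | h | h | h <;> simp only <;> omega

theorem uniqueSink : (doublingChain k).UniqueSink ⟨2 * k + 5, by omega⟩ := by
  refine ⟨?_, fun v hv => Fin.ext ?_⟩
  · rw [outdeg, filter_src_sink k _ rfl, Finset.card_empty]
  · rcases degrees k v with h | h | h | h <;> simp only <;> omega

theorem src_eq (e : ℕ) (he : e < 3 * (k + 3)) (v : ℕ) (hv : v < 2 * (k + 3))
    (h : (if e < 3 then 0 else if e = 3 * k + 8 then 2 * k + 4 else (2 * e - 1) / 3) = v) :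
    (doublingChain k).src ⟨e, he⟩ = ⟨v, hv⟩ :=
  Fin.ext ((src_val k _).trans h)

theorem mu_zero : (doublingChain k).mu ⟨0, by omega⟩ ⟨0, by omega⟩ = 1 := by
  simp [mu]

theorem mu_one : (doublingChain k).mu ⟨0, by omega⟩ ⟨1, by omega⟩ = 2 := by
  rw [mu_eq_sum (src_lt_tgt k) (by simp), filter_tgt_one k _ rfl, Finset.sum_pair (by simp),
    src_eq k 0 _ 0 (by omega) (by simp), src_eq k 1 _ 0 (by omega) (by simp), mu_zero]

theorem mu_odd_eq (i : ℕ) (hi : i ≤ k) :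
    (doublingChain k).mu ⟨0, by omega⟩ ⟨2 * i + 3, by omega⟩ =
      (doublingChain k).mu ⟨0, by omega⟩ ⟨2 * i + 2, by omega⟩ := by
  rw [mu_eq_sum (src_lt_tgt k) (by simp), filter_tgt_odd k i hi _ rfl, Finset.sum_singleton,
    src_eq k (3 * i + 4) _ (2 * i + 2) (by omega) (by split_ifs <;> omega)]

theorem mu_even (i : ℕ) (hi : i ≤ k) :
    (doublingChain k).mu ⟨0, by omega⟩ ⟨2 * i + 2, by omega⟩ = 3 * 2 ^ i := by
  induction i with
  | zero =>
    rw [mu_eq_sum (src_lt_tgt k) (by simp), filter_tgt_even k 0 hi _ rfl,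
      Finset.sum_pair (by simp), src_eq k (3 * 0 + 2) _ 0 (by omega) (by simp),
      src_eq k (3 * 0 + 3) _ 1 (by omega) (by split_ifs <;> omega), mu_zero, mu_one]
    norm_num
  | succ i ih =>
    rw [mu_eq_sum (src_lt_tgt k) (by simp), filter_tgt_even k (i + 1) hi _ rfl,
      Finset.sum_pair (by simp),
      src_eq k (3 * (i + 1) + 2) _ (2 * i + 3) (by omega) (by split_ifs <;> omega),
      src_eq k (3 * (i + 1) + 3) _ (2 * i + 3) (by omega) (by split_ifs <;> omega),
      mu_odd_eq k i (by omega), ih (by omega)]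
    ring

theorem mu_last_split :
    (doublingChain k).mu ⟨0, by omega⟩ ⟨2 * k + 4, by omega⟩ = 3 * 2 ^ k := by
  rw [mu_eq_sum (src_lt_tgt k) (by simp), filter_tgt_last_split k _ rfl, Finset.sum_singleton,
    src_eq k (3 * k + 5) _ (2 * k + 3) (by omega) (by split_ifs <;> omega),
    mu_odd_eq k k le_rfl, mu_even k k le_rfl]

theorem mu_sink :
    (doublingChain k).mu ⟨0, by omega⟩ ⟨2 * k + 5, by omega⟩ = 9 * 2 ^ k := by
  rw [mu_eq_sum (src_lt_tgt k) (by simp), filter_tgt_sink k _ rfl,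
    Finset.sum_insert (by simp), Finset.sum_pair (by simp),
    src_eq k (3 * k + 6) _ (2 * k + 3) (by omega) (by split_ifs <;> omega),
    src_eq k (3 * k + 7) _ (2 * k + 4) (by omega) (by split_ifs <;> omega),
    src_eq k (3 * k + 8) _ (2 * k + 4) (by omega) (by split_ifs <;> omega),
    mu_odd_eq k k le_rfl, mu_even k k le_rfl, mu_last_split]
  ring

end doublingChain

end Multigraph

/-- For every `n ≥ 3` the bound `9 · 2 ^ (n - 3)` is attained by some
3-regular, weakly connected, acyclic finite directed multigraph on `2n` vertices with a
unique source and a unique sink. -/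
theorem connected_bound_tight (n : ℕ) (hn : 3 ≤ n) :
    ∃ (q : ℕ) (D : Multigraph (2 * n) q) (s t : Fin (2 * n)),
      D.ThreeRegular ∧ D.WeaklyConnected ∧ D.Acyclic ∧
      D.UniqueSource s ∧ D.UniqueSink t ∧ D.mu s t = 9 * 2 ^ (n - 3) := by
  obtain ⟨k, rfl⟩ := Nat.exists_eq_add_of_le' hn
  open Multigraph doublingChain in
  exact ⟨_, doublingChain k, _, _, threeRegular k,
    weaklyConnected_of_uniqueSource (src_lt_tgt k) (uniqueSource k),
    acyclic_of_src_lt_tgt (src_lt_tgt k), uniqueSource k, uniqueSink k, mu_sink k⟩
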